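/- Let k be a field, G a group, and M a good k-linear representation of G. Then the G-finite dual M^∨ is again a good representation of G, and for every finite-dimensional simple representation S of G, the multiplicity of the dual simple representation S* in M^∨ equals the multiplicity of S in M. -/

import Mathlib

/-!
Statement 4: for a good `k`-linear representation `M` of a group `G`, the `G`-finite dual
`M^∨` is again good, and for every finite-dimensional simple representation `S` of `G` the
multiplicity of the dual simple representation `S*` in `M^∨` equals the multiplicity of
`S` in `M`. Multiplicities are measured in an arbitrary decomposition into simple
subrepresentations (they are independent of the decomposition).
-/

noncomputable section

variable {k G : Type} [Field k] [Group G]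

section Defs

variable {V W : Type} [AddCommGroup V] [Module k V] [AddCommGroup W] [Module k W]

/-- A submodule is a subrepresentation if it is stable under the `G`-action. -/
def IsSubrep (ρ : Representation k G V) (p : Submodule k V) : Prop :=
  ∀ (g : G), ∀ v ∈ p, ρ g v ∈ p

/-- A vector is `G`-finite if it lies in some finite-dimensional subrepresentation. -/
def IsGFiniteVector (ρ : Representation k G V) (v : V) : Prop :=
  ∃ p : Submodule k V, IsSubrep ρ p ∧ FiniteDimensional k p ∧ v ∈ p

/-- The subrepresentation of `G`-finite vectors of a representation. -/
def gFiniteVectors (ρ : Representation k G V) : Submodule k V where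
  carrier := {v | IsGFiniteVector ρ v}
  add_mem' := by
    rintro a b ⟨p, hp, hfp, hap⟩ ⟨q, hq, hfq, hbq⟩
    haveI := hfp; haveI := hfq
    refine ⟨p ⊔ q, ?_, inferInstance, Submodule.add_mem_sup hap hbq⟩
    intro g v hv
    rcases Submodule.mem_sup.mp hv with ⟨x, hx, y, hy, rfl⟩
    rw [map_add]
    exact Submodule.add_mem_sup (hp g x hx) (hq g y hy)
  zero_mem' := by
    refine ⟨⊥, ?_, inferInstance, Submodule.zero_mem ⊥⟩
    intro g v hv
    rw [Submodule.mem_bot] at hv ⊢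
    rw [hv, map_zero]
  smul_mem' := by
    rintro c v ⟨p, hp, hfp, hvp⟩
    exact ⟨p, hp, hfp, p.smul_mem c hvp⟩

lemma gFiniteVectors_isSubrep (ρ : Representation k G V) :
    IsSubrep ρ (gFiniteVectors ρ) := by
  rintro g v ⟨p, hp, hfp, hvp⟩
  exact ⟨p, hp, hfp, hp g v hvp⟩

/-- The restriction of a representation to a subrepresentation. -/
def subRep (ρ : Representation k G V) (p : Submodule k V) (hp : IsSubrep ρ p) :
    Representation k G p where
  toFun g := (ρ g).restrict (fun v hv => hp g v hv)
  map_one' := by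
    ext v
    simp [LinearMap.restrict_apply]
  map_mul' g h := by
    ext v
    simp [LinearMap.restrict_apply]

/-- The representation induced on a quotient by a subrepresentation. -/
def quotRep (ρ : Representation k G V) (p : Submodule k V) (hp : IsSubrep ρ p) :
    Representation k G (V ⧸ p) where
  toFun g := Submodule.mapQ p p (ρ g) (fun v hv => hp g v hv)
  map_one' := by
    apply Submodule.linearMap_qext
    ext v
    simp [Submodule.mapQ_apply]
  map_mul' g h := by
    apply Submodule.linearMap_qext
    ext v
    simp [Submodule.mapQ_apply]

/-- A linear map is `G`-equivariant for representations `ρ`, `σ`. -/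
def IsEquivariantMap (ρ : Representation k G V) (σ : Representation k G W)
    (f : V →ₗ[k] W) : Prop :=
  ∀ (g : G) (v : V), f (ρ g v) = σ g (f v)

/-- Two representations are isomorphic if there is an equivariant linear equivalence. -/
def IsRepIso (ρ : Representation k G V) (σ : Representation k G W) : Prop :=
  ∃ e : V ≃ₗ[k] W, ∀ (g : G) (v : V), e (ρ g v) = σ g (e v)

/-- A representation is simple (irreducible) if it is nonzero and has no nontrivial
subrepresentations. -/
def IsSimpleRep (ρ : Representation k G V) : Prop :=
  Nontrivial V ∧ ∀ p : Submodule k V, IsSubrep ρ p → p = ⊥ ∨ p = ⊤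

/-- A decomposition of a representation as an (internal) direct sum of simple
subrepresentations. -/
structure SimpleDecomposition (ρ : Representation k G V) where
  ι : Type
  c : ι → Submodule k V
  isSubrep : ∀ i, IsSubrep ρ (c i)
  indep : iSupIndep c
  total : ⨆ i, c i = ⊤
  simple : ∀ i, IsSimpleRep (subRep ρ (c i) (isSubrep i))

/-- The multiplicity of a representation `σ` in a simple decomposition: the cardinality of
the set of summands isomorphic to `σ`. -/
def SimpleDecomposition.mult {ρ : Representation k G V} (D : SimpleDecomposition ρ)
    {S : Type} [AddCommGroup S] [Module k S] (σ : Representation k G S) : Cardinal :=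
  Cardinal.mk {i : D.ι // IsRepIso (subRep ρ (D.c i) (D.isSubrep i)) σ}

/-- A representation is good if it is semisimple, every simple subrepresentation is
finite-dimensional, and every isomorphism class of simple representations occurs with
finite multiplicity. -/
def IsGoodRep (ρ : Representation k G V) : Prop :=
  Nonempty (SimpleDecomposition ρ) ∧
  (∀ (p : Submodule k V) (hp : IsSubrep ρ p),
      IsSimpleRep (subRep ρ p hp) → FiniteDimensional k p) ∧
  (∀ (D : SimpleDecomposition ρ) (S : Type) [AddCommGroup S] [Module k S]
      (σ : Representation k G S), IsSimpleRep σ →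
      {i : D.ι | IsRepIso (subRep ρ (D.c i) (D.isSubrep i)) σ}.Finite)

/-- The `G`-finite dual `V^∨` of a representation: the `G`-finite vectors of the full
linear dual. -/
abbrev gFinDual (ρ : Representation k G V) : Submodule k (Module.Dual k V) :=
  gFiniteVectors ρ.dual

/-- The representation of `G` on the `G`-finite dual. -/
abbrev gFinDualRep (ρ : Representation k G V) : Representation k G (gFinDual ρ) :=
  subRep ρ.dual (gFinDual ρ) (gFiniteVectors_isSubrep ρ.dual)

lemma IsEquivariantMap.dualMap {ρ : Representation k G V} {σ : Representation k G W}
    {f : V →ₗ[k] W} (hf : IsEquivariantMap ρ σ f) :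
    IsEquivariantMap σ.dual ρ.dual f.dualMap := by
  intro g φ
  ext v
  simp only [LinearMap.dualMap_apply, Representation.dual_apply, Module.Dual.transpose_apply,
    LinearMap.comp_apply, LinearMap.coe_comp, Function.comp_apply]
  rw [hf]

lemma map_gFiniteVectors_le {ρ : Representation k G V} {σ : Representation k G W}
    {f : V →ₗ[k] W} (hf : IsEquivariantMap ρ σ f) :
    (gFiniteVectors ρ).map f ≤ gFiniteVectors σ := by
  rintro _ ⟨v, ⟨p, hp, hfp, hvp⟩, rfl⟩
  haveI := hfp
  refine ⟨p.map f, ?_, inferInstance, Submodule.mem_map_of_mem hvp⟩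
  rintro g _ ⟨w, hw, rfl⟩
  rw [← hf]
  exact Submodule.mem_map_of_mem (hp g w hw)

/-- The map induced on `G`-finite vectors by an equivariant map. -/
def gFiniteMap (ρ : Representation k G V) (σ : Representation k G W)
    (f : V →ₗ[k] W) (hf : IsEquivariantMap ρ σ f) :
    gFiniteVectors ρ →ₗ[k] gFiniteVectors σ :=
  f.restrict (fun v hv => map_gFiniteVectors_le hf (Submodule.mem_map_of_mem hv))

lemma gFiniteMap_isEquivariant (ρ : Representation k G V) (σ : Representation k G W)
    (f : V →ₗ[k] W) (hf : IsEquivariantMap ρ σ f) :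
    IsEquivariantMap (subRep ρ _ (gFiniteVectors_isSubrep ρ))
      (subRep σ _ (gFiniteVectors_isSubrep σ)) (gFiniteMap ρ σ f hf) := by
  intro g v
  apply Subtype.ext
  exact hf g v.1

/-- The map induced on `G`-finite duals by an equivariant map (the restricted transpose). -/
abbrev gFinDualMap (ρ : Representation k G V) (σ : Representation k G W)
    (f : V →ₗ[k] W) (hf : IsEquivariantMap ρ σ f) :
    gFinDual σ →ₗ[k] gFinDual ρ :=
  gFiniteMap σ.dual ρ.dual f.dualMap hf.dualMap

lemma gFinDualMap_isEquivariant (ρ : Representation k G V) (σ : Representation k G W)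
    (f : V →ₗ[k] W) (hf : IsEquivariantMap ρ σ f) :
    IsEquivariantMap (V := gFinDual σ) (W := gFinDual ρ)
      (gFinDualRep σ) (gFinDualRep ρ) (gFinDualMap ρ σ f hf) :=
  gFiniteMap_isEquivariant σ.dual ρ.dual f.dualMap hf.dualMap


section Helpers

variable {V W U : Type} [AddCommGroup V] [Module k V] [AddCommGroup W] [Module k W]
  [AddCommGroup U] [Module k U]

lemma subRep_coe (ρ : Representation k G V) (p : Submodule k V) (hp : IsSubrep ρ p)
    (g : G) (v : p) : ((subRep ρ p hp g v : p) : V) = ρ g v := rfl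

lemma IsRepIso.symm' {ρ : Representation k G V} {σ : Representation k G W}
    (h : IsRepIso ρ σ) : IsRepIso σ ρ := by
  obtain ⟨e, he⟩ := h
  refine ⟨e.symm, fun g v => ?_⟩
  apply e.injective
  rw [he]; simp

lemma IsRepIso.trans' {ρ : Representation k G V} {σ : Representation k G W}
    {τ : Representation k G U} (h : IsRepIso ρ σ) (h' : IsRepIso σ τ) : IsRepIso ρ τ := by
  obtain ⟨e, he⟩ := h
  obtain ⟨f, hf⟩ := h'
  refine ⟨e.trans f, fun g v => ?_⟩
  simp [he, hf]

lemma IsRepIso.dual' {ρ : Representation k G V} {σ : Representation k G W}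
    (h : IsRepIso ρ σ) : IsRepIso ρ.dual σ.dual := by
  obtain ⟨e, he⟩ := h.symm'
  exact ⟨e.dualMap, fun g φ =>
    IsEquivariantMap.dualMap (ρ := σ) (σ := ρ) (f := e.toLinearMap) he g φ⟩

lemma isRepIso_dual_dual [FiniteDimensional k V] (ρ : Representation k G V) :
    IsRepIso ρ ρ.dual.dual := by
  refine ⟨Module.evalEquiv k V, fun g v => ?_⟩
  ext φ
  simp [Representation.dual_apply, Module.Dual.transpose_apply]

lemma IsRepIso.of_dual [FiniteDimensional k V] [FiniteDimensional k W]
    {ρ : Representation k G V} {σ : Representation k G W}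
    (h : IsRepIso ρ.dual σ.dual) : IsRepIso ρ σ :=
  ((isRepIso_dual_dual ρ).trans' h.dual').trans' (isRepIso_dual_dual σ).symm'

lemma IsSimpleRep.of_iso {ρ : Representation k G V} {σ : Representation k G W}
    (h : IsRepIso ρ σ) (hs : IsSimpleRep ρ) : IsSimpleRep σ := by
  obtain ⟨e, he⟩ := h
  haveI := hs.1
  refine ⟨e.symm.toEquiv.nontrivial, fun p hp => ?_⟩
  have h1 : IsSubrep ρ (p.comap e.toLinearMap) := by
    intro g v hv
    have := hp g _ hv
    simpa [he] using this
  have h2 : p = (p.comap e.toLinearMap).map e.toLinearMap :=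
    (Submodule.map_comap_eq_of_surjective e.surjective p).symm
  rcases hs.2 _ h1 with h | h
  · left; rw [h2, h, Submodule.map_bot]
  · right; rw [h2, h, Submodule.map_top]; exact LinearEquiv.range e

lemma IsSimpleRep.dual' [FiniteDimensional k V] {ρ : Representation k G V}
    (hs : IsSimpleRep ρ) : IsSimpleRep ρ.dual := by
  haveI := hs.1
  refine ⟨inferInstance, fun p hp => ?_⟩
  have h1 : IsSubrep ρ p.dualCoannihilator := by
    intro g v hv
    rw [Submodule.mem_dualCoannihilator] at hv ⊢
    intro φ hφ
    have := hv _ (hp g⁻¹ φ hφ)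
    simpa [Representation.dual_apply, Module.Dual.transpose_apply] using this
  have h2 : p.dualCoannihilator.dualAnnihilator = p := Subspace.dualCoannihilator_dualAnnihilator_eq
  rcases hs.2 _ h1 with h | h
  · right; rw [← h2, h, Submodule.dualAnnihilator_bot]
  · left; rw [← h2, h, Submodule.dualAnnihilator_top]

/-- Schur. -/
lemma schur_iso {ρ : Representation k G V} {σ : Representation k G W}
    (hρ : IsSimpleRep ρ) (hσ : IsSimpleRep σ) (f : V →ₗ[k] W)
    (hf : IsEquivariantMap ρ σ f) (h0 : f ≠ 0) : IsRepIso ρ σ := by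
  have hk : IsSubrep ρ (LinearMap.ker f) := by
    intro g v hv
    rw [LinearMap.mem_ker] at hv ⊢
    rw [hf, hv, map_zero]
  have hr : IsSubrep σ (LinearMap.range f) := by
    rintro g _ ⟨v, rfl⟩
    exact ⟨ρ g v, hf g v⟩
  have hk' : LinearMap.ker f = ⊥ := by
    rcases hρ.2 _ hk with h | h
    · exact h
    · exact absurd (LinearMap.ker_eq_top.mp h) h0
  have hr' : LinearMap.range f = ⊤ := by
    rcases hσ.2 _ hr with h | h
    · exact absurd (LinearMap.range_eq_bot.mp h) h0
    · exact h
  exact ⟨LinearEquiv.ofBijective f ⟨LinearMap.ker_eq_bot.mp hk', LinearMap.range_eq_top.mp hr'⟩,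
    fun g v => hf g v⟩

lemma isRepIso_range {ρ : Representation k G V} {σ : Representation k G W}
    (f : V →ₗ[k] W) (hf : IsEquivariantMap ρ σ f) (hi : Function.Injective f)
    (hr : IsSubrep σ (LinearMap.range f)) :
    IsRepIso ρ (subRep σ (LinearMap.range f) hr) :=
  ⟨LinearEquiv.ofInjective f hi, fun g v => Subtype.ext (hf g v)⟩

lemma schur_iso' {ρ : Representation k G V} {σ : Representation k G W} {τ : Representation k G U}
    (hρ : IsSimpleRep ρ) (hσ : IsSimpleRep σ) (f : V →ₗ[k] U) (g : W →ₗ[k] U)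
    (hf : IsEquivariantMap ρ τ f) (hg : IsEquivariantMap σ τ g) (h0 : f ≠ 0)
    (hi : Function.Injective g) (hle : ∀ v, f v ∈ LinearMap.range g) : IsRepIso ρ σ := by
  choose F hF using hle
  let F' : V →ₗ[k] W :=
    { toFun := F
      map_add' := fun x y => hi (by simp [hF])
      map_smul' := fun c x => hi (by simp [hF]) }
  refine schur_iso hρ hσ F' ?_ ?_
  · intro x v
    apply hi
    change g (F _) = g (σ x (F v))
    rw [hF, hg, hF, hf]
  · rintro h
    apply h0
    ext v
    rw [← hF v]
    have : F v = 0 := congrArg (fun l : V →ₗ[k] W => l v) h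
    simp [this]

lemma simple_le_or_disjoint {ρ : Representation k G V} {p N : Submodule k V}
    (hp : IsSubrep ρ p) (hs : IsSimpleRep (subRep ρ p hp)) (hN : IsSubrep ρ N) :
    p ≤ N ∨ Disjoint p N := by
  have h1 : IsSubrep (subRep ρ p hp) (N.comap p.subtype) := fun g v hv => hN g _ hv
  rcases hs.2 _ h1 with h | h
  · right
    rw [Submodule.disjoint_def]
    intro x hx hxN
    have : (⟨x, hx⟩ : p) ∈ N.comap p.subtype := hxN
    rw [h, Submodule.mem_bot] at this
    exact congrArg Subtype.val this
  · left
    exact Submodule.comap_subtype_eq_top.mp h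

lemma simple_ne_bot {ρ : Representation k G V} {p : Submodule k V}
    (hp : IsSubrep ρ p) (hs : IsSimpleRep (subRep ρ p hp)) : p ≠ ⊥ := by
  rintro rfl
  obtain ⟨x, y, hxy⟩ := hs.1
  exact hxy (Subsingleton.elim x y)

lemma IsSubrep.sup' {ρ : Representation k G V} {p q : Submodule k V}
    (hp : IsSubrep ρ p) (hq : IsSubrep ρ q) : IsSubrep ρ (p ⊔ q) := by
  intro g v hv
  rcases Submodule.mem_sup.mp hv with ⟨x, hx, y, hy, rfl⟩
  rw [map_add]
  exact Submodule.add_mem_sup (hp g x hx) (hq g y hy)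

lemma IsSubrep.iSup' {ρ : Representation k G V} {ι : Sort*} {p : ι → Submodule k V}
    (hp : ∀ i, IsSubrep ρ (p i)) : IsSubrep ρ (⨆ i, p i) := by
  intro g
  change (⨆ i, p i) ≤ (⨆ i, p i).comap (ρ g)
  exact iSup_le fun i v hv => Submodule.mem_iSup_of_mem i (hp i g v hv)

lemma iso_of_le_sup {ρ : Representation k G V} {p q N : Submodule k V}
    (hp : IsSubrep ρ p) (hps : IsSimpleRep (subRep ρ p hp))
    (hq : IsSubrep ρ q) (hqs : IsSimpleRep (subRep ρ q hq)) (hN : IsSubrep ρ N)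
    (hpN : ¬ p ≤ N) (hqN : ¬ q ≤ N) (hle : p ≤ N ⊔ q) :
    IsRepIso (subRep ρ p hp) (subRep ρ q hq) := by
  refine schur_iso' (τ := quotRep ρ N hN) hps hqs (N.mkQ ∘ₗ p.subtype) (N.mkQ ∘ₗ q.subtype)
    (fun g v => rfl) (fun g v => rfl) ?_ ?_ ?_
  · intro h
    apply hpN
    intro x hx
    have := congrArg (fun l => l (⟨x, hx⟩ : p)) h
    simpa using this
  · have hd := (simple_le_or_disjoint hq hqs hN).resolve_left hqN
    rw [← LinearMap.ker_eq_bot, LinearMap.ker_eq_bot']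
    intro x hx
    have hx' : (x : V) ∈ N := by simpa using hx
    exact Subtype.ext (Submodule.disjoint_def.mp hd _ x.2 hx')
  · intro v
    obtain ⟨n, hn, y, hy, h⟩ := Submodule.mem_sup.mp (hle v.2)
    refine ⟨⟨y, hy⟩, ?_⟩
    simp only [LinearMap.comp_apply, Submodule.subtype_apply, ← h, map_add]
    rw [show N.mkQ n = 0 by simpa using hn, zero_add]

lemma exists_iso_finset {ρ : Representation k G V} {ι : Type} (c : ι → Submodule k V)
    (hc : ∀ i, IsSubrep ρ (c i)) (hcs : ∀ i, IsSimpleRep (subRep ρ (c i) (hc i)))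
    {p : Submodule k V} (hp : IsSubrep ρ p) (hps : IsSimpleRep (subRep ρ p hp)) (J : Finset ι) :
    ∀ N : Submodule k V, IsSubrep ρ N → ¬ p ≤ N → p ≤ N ⊔ ⨆ j ∈ J, c j →
      ∃ j ∈ J, ¬ c j ≤ N ∧ IsRepIso (subRep ρ p hp) (subRep ρ (c j) (hc j)) := by
  classical
  induction J using Finset.induction_on with
  | empty =>
    intro N hN h1 h2
    simp at h2
    exact absurd h2 h1
  | insert a J ha ih =>
    intro N hN h1 h2
    by_cases h3 : p ≤ N ⊔ c a
    · have h4 : ¬ c a ≤ N := fun h => h1 (h3.trans (sup_le le_rfl h))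
      exact ⟨a, Finset.mem_insert_self _ _, h4, iso_of_le_sup hp hps (hc a) (hcs a) hN h1 h4 h3⟩
    · rw [Finset.iSup_insert, ← sup_assoc] at h2
      obtain ⟨j, hj, hjN, hiso⟩ := ih (N ⊔ c a) (hN.sup' (hc a)) h3 h2
      exact ⟨j, Finset.mem_insert_of_mem hj, fun h => hjN (h.trans le_sup_left), hiso⟩

lemma exists_iso {ρ : Representation k G V} (D : SimpleDecomposition ρ)
    {p : Submodule k V} (hp : IsSubrep ρ p) (hps : IsSimpleRep (subRep ρ p hp))
    {N : Submodule k V} (hN : IsSubrep ρ N) (hpN : ¬ p ≤ N) :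
    ∃ j, ¬ D.c j ≤ N ∧ IsRepIso (subRep ρ p hp) (subRep ρ (D.c j) (D.isSubrep j)) := by
  obtain ⟨x, hx, hx0⟩ := Submodule.exists_mem_ne_zero_of_ne_bot (simple_ne_bot hp hps)
  have hxt : x ∈ ⨆ i, D.c i := by rw [D.total]; trivial
  obtain ⟨J, hJ⟩ := Submodule.mem_iSup_iff_exists_finset.mp hxt
  have hJs : IsSubrep ρ (⨆ j ∈ J, D.c j) :=
    IsSubrep.iSup' fun i => IsSubrep.iSup' fun _ => D.isSubrep i
  have hle : p ≤ ⨆ j ∈ J, D.c j := by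
    refine (simple_le_or_disjoint hp hps hJs).resolve_right fun h => hx0 ?_
    exact Submodule.disjoint_def.mp h x hx hJ
  obtain ⟨j, _, h1, h2⟩ := exists_iso_finset D.c D.isSubrep D.simple hp hps J N hN hpN
    (hle.trans le_sup_right)
  exact ⟨j, h1, h2⟩

/-- The isotypic part. -/
def isoPart {ρ : Representation k G V} (D : SimpleDecomposition ρ)
    (σ : Representation k G W) : Submodule k V :=
  ⨆ i : {i : D.ι // IsRepIso (subRep ρ (D.c i) (D.isSubrep i)) σ}, D.c i

lemma isoPart_le {ρ : Representation k G V} (D E : SimpleDecomposition ρ)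
    (σ : Representation k G W) : isoPart D σ ≤ isoPart E σ := by
  refine iSup_le ?_
  rintro ⟨i, hi⟩
  by_contra hcon
  have hN : IsSubrep ρ (isoPart E σ) := IsSubrep.iSup' fun j => E.isSubrep j
  obtain ⟨j, h1, h2⟩ := exists_iso E (D.isSubrep i) (D.simple i) hN hcon
  exact h1 (le_iSup (fun i : {i : E.ι // IsRepIso (subRep ρ (E.c i) (E.isSubrep i)) σ} => E.c i)
    ⟨j, h2.symm'.trans' hi⟩)

lemma rank_isoPart {ρ : Representation k G V} (D : SimpleDecomposition ρ)
    (σ : Representation k G W) :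
    Module.rank k (isoPart D σ) = D.mult σ * Module.rank k W := by
  classical
  have hind : iSupIndep (fun i : {i : D.ι // IsRepIso (subRep ρ (D.c i) (D.isSubrep i)) σ} =>
      D.c i) := D.indep.comp Subtype.val_injective
  have h1 := (LinearEquiv.ofInjective _ hind.dfinsupp_lsum_injective).trans
    (LinearEquiv.ofEq _ _ (Submodule.iSup_eq_range_dfinsupp_lsum _).symm)
  have h2 : ∀ i : {i : D.ι // IsRepIso (subRep ρ (D.c i) (D.isSubrep i)) σ},
      Module.rank k (D.c i) = Module.rank k W := by
    rintro ⟨i, e, he⟩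
    exact e.rank_eq
  have h3 := rank_directSum (R := k)
    (fun i : {i : D.ι // IsRepIso (subRep ρ (D.c i) (D.isSubrep i)) σ} => D.c i)
  have h4 := h1.rank_eq
  unfold isoPart
  rw [← h4]
  refine h3.trans ?_
  simp only [h2]
  simp [SimpleDecomposition.mult]

lemma mult_eq {ρ : Representation k G V} (D E : SimpleDecomposition ρ)
    [FiniteDimensional k W] [Nontrivial W] (σ : Representation k G W) :
    D.mult σ = E.mult σ := by
  have h : isoPart D σ = isoPart E σ := le_antisymm (isoPart_le D E σ) (isoPart_le E D σ)
  have h1 := rank_isoPart D σ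
  rw [h, rank_isoPart E σ, ← Module.finrank_eq_rank] at h1
  exact ((Cardinal.mul_natCast_inj Module.finrank_pos.ne').mp h1).symm

/-- A finite-dimensional space of functionals only sees finitely many summands. -/
lemma finite_not_le {ρ : Representation k G V} (hgood : IsGoodRep ρ) (D : SimpleDecomposition ρ)
    (p : Submodule k (Module.Dual k V)) (hp : IsSubrep ρ.dual p) [FiniteDimensional k p] :
    {i | ¬ D.c i ≤ p.dualCoannihilator}.Finite := by
  classical
  set N := p.dualCoannihilator with hNdef
  have hN : IsSubrep ρ N := by
    intro g v hv
    rw [hNdef, Submodule.mem_dualCoannihilator] at hv ⊢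
    intro φ hφ
    have := hv _ (hp g⁻¹ φ hφ)
    simpa [Representation.dual_apply, Module.Dual.transpose_apply] using this
  haveI : FiniteDimensional k (V ⧸ N) :=
    Subspace.finiteDimensional_quot_dualCoannihilator_iff.mpr inferInstance
  have hc : IsCompactElement (⊤ : Submodule k (V ⧸ N)) :=
    (Submodule.fg_iff_compact _).mp (Module.finite_def.mp inferInstance)
  have htop : (⊤ : Submodule k (V ⧸ N)) ≤ ⨆ i, (D.c i).map N.mkQ := by
    rw [← Submodule.map_iSup, D.total, Submodule.map_top, Submodule.range_mkQ]
  obtain ⟨J, hJ⟩ := CompleteLattice.IsCompactElement.exists_finset_of_le_iSup _ hc _ htop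
  have hJ' : (⊤ : Submodule k V) ≤ N ⊔ ⨆ j ∈ J, D.c j := by
    simp only [← Submodule.map_iSup] at hJ
    rw [← Submodule.comap_map_mkQ]
    intro x _
    exact hJ trivial
  refine ((J.finite_toSet.biUnion (t := fun j =>
    {i : D.ι | IsRepIso (subRep ρ (D.c i) (D.isSubrep i)) (subRep ρ (D.c j) (D.isSubrep j))})
    fun j _ => hgood.2.2 D _ _ (D.simple j))).subset ?_
  intro i hi
  obtain ⟨j, hj, _, hiso⟩ := exists_iso_finset D.c D.isSubrep D.simple (D.isSubrep i) (D.simple i)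
    J N hN hi (le_top.trans hJ')
  exact Set.mem_biUnion (Finset.mem_coe.mpr hj) hiso

lemma isCompl_rest {ρ : Representation k G V} (D : SimpleDecomposition ρ) (i : D.ι) :
    IsCompl (D.c i) (⨆ (j) (_ : j ≠ i), D.c j) := by
  refine ⟨D.indep i, ?_⟩
  rw [codisjoint_iff_le_sup, ← D.total]
  refine iSup_le fun j => ?_
  by_cases h : j = i
  · subst h; exact le_sup_left
  · exact le_sup_of_le_right (le_iSup₂_of_le j h le_rfl)

/-- Projection to a summand. -/
def projTo {ρ : Representation k G V} (D : SimpleDecomposition ρ) (i : D.ι) :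
    V →ₗ[k] D.c i :=
  (D.c i).projectionOnto _ (isCompl_rest D i)

lemma projTo_self {ρ : Representation k G V} (D : SimpleDecomposition ρ) (i : D.ι)
    (x : D.c i) : projTo D i x = x :=
  Submodule.projectionOnto_apply_left _ x

lemma projTo_ne {ρ : Representation k G V} (D : SimpleDecomposition ρ) {i j : D.ι} (h : j ≠ i)
    {x : V} (hx : x ∈ D.c j) : projTo D i x = 0 :=
  Submodule.projectionOnto_apply_of_mem_right _
    ((le_iSup₂_of_le (f := fun j (_ : j ≠ i) => D.c j) j h le_rfl) hx)

lemma projTo_equivariant {ρ : Representation k G V} (D : SimpleDecomposition ρ) (i : D.ι) :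
    IsEquivariantMap ρ (subRep ρ (D.c i) (D.isSubrep i)) (projTo D i) := by
  intro g v
  have hv : v ∈ ⨆ j, D.c j := by rw [D.total]; trivial
  induction hv using Submodule.iSup_induction' with
  | mem j x hx =>
    by_cases h : j = i
    · subst h
      rw [projTo_self D j ⟨x, hx⟩]
      exact projTo_self D j ⟨ρ g x, D.isSubrep j g x hx⟩
    · rw [projTo_ne D h hx, projTo_ne D h (D.isSubrep j g x hx), map_zero]
  | zero => simp
  | add x y _ _ hx hy => simp only [map_add, hx, hy]

lemma dual_ext_decomp {ρ : Representation k G V} (D : SimpleDecomposition ρ)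
    {f h : Module.Dual k V} (H : ∀ i, ∀ x ∈ D.c i, f x = h x) : f = h := by
  have : (⊤ : Submodule k V) ≤ LinearMap.eqLocus f h := by
    rw [← D.total]
    exact iSup_le fun i x hx => H i x hx
  ext x
  exact this (Submodule.mem_top (x := x))

/-- An abstract model of the `G`-finite dual. -/
structure FinDualModel (ρ : Representation k G V) {X : Type} [AddCommGroup X] [Module k X]
    (τ : Representation k G X) where
  inc : X →ₗ[k] Module.Dual k V
  inj : Function.Injective inc
  equi : IsEquivariantMap τ ρ.dual inc
  fin : ∀ x, IsGFiniteVector ρ.dual (inc x)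
  surj : ∀ φ, IsGFiniteVector ρ.dual φ → ∃ x, inc x = φ

section Model

variable {X : Type} [AddCommGroup X] [Module k X] {τ : Representation k G X}

lemma exists_extDual {ρ : Representation k G V} (m : FinDualModel ρ τ)
    (D : SimpleDecomposition ρ) (hfd : ∀ i, FiniteDimensional k (D.c i)) (i : D.ι)
    (φ : Module.Dual k (D.c i)) : ∃ x, m.inc x = (projTo D i).dualMap φ := by
  haveI := hfd i
  exact m.surj _ (map_gFiniteVectors_le (projTo_equivariant D i).dualMap
      (Submodule.mem_map_of_mem ⟨⊤, fun _ _ _ => trivial, inferInstance, trivial⟩))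

/-- Extension by zero of functionals on a summand. -/
def extDual {ρ : Representation k G V} (m : FinDualModel ρ τ)
    (D : SimpleDecomposition ρ) (hfd : ∀ i, FiniteDimensional k (D.c i)) (i : D.ι) :
    Module.Dual k (D.c i) →ₗ[k] X where
  toFun φ := (exists_extDual m D hfd i φ).choose
  map_add' x y := m.inj (by
    refine (exists_extDual m D hfd i _).choose_spec.trans ?_
    refine Eq.trans ?_ (map_add m.inc _ _).symm
    refine Eq.trans (map_add _ x y) ?_
    exact congrArg₂ _ (exists_extDual m D hfd i x).choose_spec.symm
      (exists_extDual m D hfd i y).choose_spec.symm)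
  map_smul' c x := m.inj (by
    refine (exists_extDual m D hfd i _).choose_spec.trans ?_
    refine Eq.trans ?_ (map_smul m.inc c _).symm
    refine Eq.trans (map_smul _ c x) ?_
    exact congrArg _ (exists_extDual m D hfd i x).choose_spec.symm)

lemma inc_extDual {ρ : Representation k G V} (m : FinDualModel ρ τ)
    (D : SimpleDecomposition ρ) (hfd : ∀ i, FiniteDimensional k (D.c i)) (i : D.ι)
    (φ : Module.Dual k (D.c i)) : m.inc (extDual m D hfd i φ) = (projTo D i).dualMap φ :=
  (exists_extDual m D hfd i φ).choose_spec

lemma extDual_apply {ρ : Representation k G V} (m : FinDualModel ρ τ)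
    (D : SimpleDecomposition ρ) (hfd : ∀ i, FiniteDimensional k (D.c i)) (i : D.ι)
    (φ : Module.Dual k (D.c i)) (v : V) :
    m.inc (extDual m D hfd i φ) v = φ (projTo D i v) := by
  rw [inc_extDual]; rfl

lemma extDual_equivariant {ρ : Representation k G V} (m : FinDualModel ρ τ)
    (D : SimpleDecomposition ρ) (hfd : ∀ i, FiniteDimensional k (D.c i)) (i : D.ι) :
    IsEquivariantMap (subRep ρ (D.c i) (D.isSubrep i)).dual τ (extDual m D hfd i) := by
  intro g φ
  apply m.inj
  rw [m.equi, inc_extDual, inc_extDual]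
  exact (projTo_equivariant D i).dualMap g φ

lemma extDual_injective {ρ : Representation k G V} (m : FinDualModel ρ τ)
    (D : SimpleDecomposition ρ) (hfd : ∀ i, FiniteDimensional k (D.c i)) (i : D.ι) :
    Function.Injective (extDual m D hfd i) := by
  intro φ ψ h
  ext x
  have := congrArg (fun f => m.inc f x) h
  simpa only [extDual_apply, projTo_self] using this

lemma extDual_range_isSubrep {ρ : Representation k G V} (m : FinDualModel ρ τ)
    (D : SimpleDecomposition ρ) (hfd : ∀ i, FiniteDimensional k (D.c i)) (i : D.ι) :
    IsSubrep τ (LinearMap.range (extDual m D hfd i)) := by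
  rintro g _ ⟨φ, rfl⟩
  exact ⟨_, extDual_equivariant m D hfd i g φ⟩

/-- The dual decomposition. -/
def dualDecomp {ρ : Representation k G V} (m : FinDualModel ρ τ) (hgood : IsGoodRep ρ)
    (D : SimpleDecomposition ρ) (hfd : ∀ i, FiniteDimensional k (D.c i)) :
    SimpleDecomposition τ where
  ι := D.ι
  c i := LinearMap.range (extDual m D hfd i)
  isSubrep i := extDual_range_isSubrep m D hfd i
  indep := by
    intro i
    rw [Submodule.disjoint_def]
    rintro _ ⟨φ, rfl⟩ h2
    have hle : (⨆ (j) (_ : j ≠ i), LinearMap.range (extDual m D hfd j)) ≤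
        (D.c i).dualAnnihilator.comap m.inc := by
      refine iSup₂_le fun j hj => ?_
      rintro _ ⟨ψ, rfl⟩
      rw [Submodule.mem_comap, Submodule.mem_dualAnnihilator]
      intro x hx
      rw [extDual_apply, projTo_ne D hj.symm hx, map_zero]
    have h3 := hle h2
    rw [Submodule.mem_comap, Submodule.mem_dualAnnihilator] at h3
    have : φ = 0 := by
      ext x
      have := h3 x x.2
      rwa [extDual_apply, projTo_self] at this
    rw [this, map_zero]
  total := by
    classical
    rw [eq_top_iff]
    rintro f -
    obtain ⟨p, hp, hfp, hfm⟩ := m.fin f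
    have hfin := finite_not_le hgood D p hp
    have hsum : f =
        ∑ i ∈ hfin.toFinset, extDual m D hfd i (m.inc f ∘ₗ (D.c i).subtype) := by
      apply m.inj
      apply dual_ext_decomp D
      intro i x hx
      rw [map_sum, LinearMap.sum_apply]
      simp only [extDual_apply]
      rw [Finset.sum_eq_single i]
      · rw [projTo_self D i ⟨x, hx⟩]; rfl
      · intro j _ hj
        rw [projTo_ne D hj.symm hx, map_zero]
      · intro hi
        have hi' : D.c i ≤ p.dualCoannihilator := by simpa using hi
        rw [projTo_self D i ⟨x, hx⟩]
        exact (Submodule.mem_dualCoannihilator _).mp (hi' hx) (m.inc f) hfm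
    rw [hsum]
    exact Submodule.sum_mem _ fun i _ => Submodule.mem_iSup_of_mem i ⟨_, rfl⟩
  simple i := by
    haveI := hfd i
    exact (D.simple i).dual'.of_iso
      (isRepIso_range _ (extDual_equivariant m D hfd i) (extDual_injective m D hfd i)
        (extDual_range_isSubrep m D hfd i))

lemma dualDecomp_iso {ρ : Representation k G V} (m : FinDualModel ρ τ) (hgood : IsGoodRep ρ)
    (D : SimpleDecomposition ρ) (hfd : ∀ i, FiniteDimensional k (D.c i)) (i : D.ι) :
    IsRepIso (subRep ρ (D.c i) (D.isSubrep i)).dual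
      (subRep τ ((dualDecomp m hgood D hfd).c i) ((dualDecomp m hgood D hfd).isSubrep i)) :=
  isRepIso_range _ (extDual_equivariant m D hfd i) (extDual_injective m D hfd i)
      (extDual_range_isSubrep m D hfd i)

lemma model_simple_finite {ρ : Representation k G V} (m : FinDualModel ρ τ) (p : Submodule k X)
    (hp : IsSubrep τ p) (hs : IsSimpleRep (subRep τ p hp)) :
    FiniteDimensional k p := by
  obtain ⟨x, hx, hx0⟩ := Submodule.exists_mem_ne_zero_of_ne_bot (simple_ne_bot hp hs)
  obtain ⟨q, hq, hqf, hxq⟩ := m.fin x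
  have hq' : IsSubrep τ (q.comap m.inc) := by
    intro g v hv
    rw [Submodule.mem_comap, m.equi]
    exact hq g _ hv
  have hle : p ≤ q.comap m.inc := by
    refine (simple_le_or_disjoint hp hs hq').resolve_right fun h => hx0 ?_
    exact Submodule.disjoint_def.mp h x hx hxq
  exact FiniteDimensional.of_injective
      (m.inc.restrict (p := p) (q := q) fun x hx => hle hx)
      (fun a b h => Subtype.ext (m.inj (congrArg (fun z : q => (z : Module.Dual k V)) h)))

lemma finite_of_isRepIso {ρ : Representation k G V} {σ : Representation k G W}
    (h : IsRepIso ρ σ) (hV : FiniteDimensional k V) : FiniteDimensional k W := by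
  obtain ⟨e, -⟩ := h
  exact e.finiteDimensional

theorem model_main {ρ : Representation k G V} (m : FinDualModel ρ τ) (hgood : IsGoodRep ρ) :
    IsGoodRep τ ∧
      ∀ (S : Type) [AddCommGroup S] [Module k S] (σ : Representation k G S),
        FiniteDimensional k S → IsSimpleRep σ →
        ∀ (D : SimpleDecomposition ρ) (E : SimpleDecomposition τ),
          E.mult σ.dual = D.mult σ := by
  have hfd : ∀ (D : SimpleDecomposition ρ) i, FiniteDimensional k (D.c i) :=
    fun D i => hgood.2.1 _ _ (D.simple i)
  refine ⟨⟨?_, ?_, ?_⟩, ?_⟩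
  · obtain ⟨D⟩ := hgood.1
    exact ⟨dualDecomp m hgood D (hfd D)⟩
  · exact fun p hp hs => model_simple_finite m p hp hs
  · intro E S _ _ σ hσ
    by_cases hS : FiniteDimensional k S
    · obtain ⟨D⟩ := hgood.1
      haveI := hσ.1
      have hm := mult_eq E (dualDecomp m hgood D (hfd D)) σ
      have hfin : {i : D.ι | IsRepIso (subRep τ ((dualDecomp m hgood D (hfd D)).c i)
          ((dualDecomp m hgood D (hfd D)).isSubrep i)) σ}.Finite := by
        rcases Set.eq_empty_or_nonempty {i : D.ι | IsRepIso (subRep τ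
          ((dualDecomp m hgood D (hfd D)).c i)
          ((dualDecomp m hgood D (hfd D)).isSubrep i)) σ} with h | ⟨i₀, hi₀⟩
        · rw [h]; exact Set.finite_empty
        · refine (hgood.2.2 D _ _ (D.simple i₀)).subset fun i hi => ?_
          haveI := hfd D i
          haveI := hfd D i₀
          exact IsRepIso.of_dual (((dualDecomp_iso m hgood D (hfd D) i).trans' hi).trans'
            ((dualDecomp_iso m hgood D (hfd D) i₀).trans' hi₀).symm')
      have h1 : (dualDecomp m hgood D (hfd D)).mult σ < Cardinal.aleph0 :=
        Cardinal.lt_aleph0_iff_set_finite.mpr hfin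
      rw [← hm] at h1
      exact Cardinal.lt_aleph0_iff_set_finite.mp h1
    · convert Set.finite_empty
      rw [Set.eq_empty_iff_forall_notMem]
      intro i hi
      exact hS (finite_of_isRepIso (Set.mem_setOf_eq ▸ hi)
        (model_simple_finite m _ _ (E.simple i)))
  · intro S _ _ σ hS hσ D E
    haveI := hσ.dual'.1
    rw [mult_eq E (dualDecomp m hgood D (hfd D)) σ.dual]
    refine Cardinal.mk_congr (Equiv.subtypeEquivRight fun i => ?_)
    haveI := hfd D i
    exact ⟨fun h => IsRepIso.of_dual ((dualDecomp_iso m hgood D (hfd D) i).trans' h),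
      fun h => (dualDecomp_iso m hgood D (hfd D) i).symm'.trans' h.dual'⟩

end Model

end Helpers

/-- The `G`-finite dual of a good representation is good, and for every
finite-dimensional simple representation `S` of `G`, the multiplicity of `S*` in `M^∨`
(computed in any simple decomposition of `M^∨`) equals the multiplicity of `S` in `M`
(computed in any simple decomposition of `M`). -/
theorem gFinDualRep_isGood_and_mult_dual
    {M : Type} [AddCommGroup M] [Module k M] (ρ : Representation k G M)
    (hgood : IsGoodRep ρ) :
    IsGoodRep (V := gFinDual ρ) (gFinDualRep ρ) ∧
      ∀ (S : Type) [AddCommGroup S] [Module k S] (σ : Representation k G S),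
        FiniteDimensional k S → IsSimpleRep σ →
        ∀ (D : SimpleDecomposition ρ)
          (E : SimpleDecomposition (V := gFinDual ρ) (gFinDualRep ρ)),
          E.mult σ.dual = D.mult σ := by
  exact model_main (X := gFinDual ρ) (τ := gFinDualRep ρ)
    { inc := (gFinDual ρ).subtype
      inj := Subtype.val_injective
      equi := fun _ _ => rfl
      fin := fun x => x.2
      surj := fun φ h => ⟨⟨φ, h⟩, rfl⟩ } hgood

end Defs

end
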